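/- For α ∈ RO and any real s with s > σ₁(α), the weight ratio α(⟨ξ⟩)/⟨ξ⟩^s tends to 0 as |ξ| → ∞; consequently the embedding H^{(s)}(ℝⁿ) ⊂ H^α(ℝⁿ) restricted to distributions supported in a fixed compact set is compact. -/

import Mathlib

noncomputable section
open MeasureTheory Filter Set Real

/-- Class RO of RO-varying (in the sense of Avakumović) functions at infinity:
Borel measurable on `[1,∞)`, positive there, with `c⁻¹ ≤ α(l*t)/α(t) ≤ c`
for all `t ≥ 1`, `l ∈ [1,b]`. -/
def RO (α : ℝ → ℝ) : Prop :=
  (∀ t, 1 ≤ t → 0 < α t) ∧ (Measurable fun t : Set.Ici (1:ℝ) => α t.1) ∧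
  ∃ b : ℝ, 1 < b ∧ ∃ c : ℝ, 1 ≤ c ∧ ∀ t, 1 ≤ t → ∀ l, 1 ≤ l → l ≤ b →
    c⁻¹ ≤ α (l * t) / α t ∧ α (l * t) / α t ≤ c

/-- Exponents admitting a lower power bound `c * l^s ≤ α(l*t)/α(t)`. -/
def roLowerSet (α : ℝ → ℝ) : Set ℝ :=
  {s | ∃ c : ℝ, 0 < c ∧ ∀ t, 1 ≤ t → ∀ l, 1 ≤ l → c * l ^ s ≤ α (l * t) / α t}

/-- Exponents admitting an upper power bound `α(l*t)/α(t) ≤ c * l^s`. -/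
def roUpperSet (α : ℝ → ℝ) : Set ℝ :=
  {s | ∃ c : ℝ, 0 < c ∧ ∀ t, 1 ≤ t → ∀ l, 1 ≤ l → α (l * t) / α t ≤ c * l ^ s}

/-- Lower Matuszewska index. -/
def sigma0 (α : ℝ → ℝ) : ℝ := sSup (roLowerSet α)

/-- Upper Matuszewska index. -/
def sigma1 (α : ℝ → ℝ) : ℝ := sInf (roUpperSet α)

open scoped ENNReal NNReal

abbrev Eucl (n : ℕ) := EuclideanSpace ℝ (Fin n)

/-- The smoothed modulus `⟨ξ⟩ = (1+|ξ|²)^{1/2}`. -/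
def jap {n : ℕ} (ξ : Eucl n) : ℝ := Real.sqrt (1 + ‖ξ‖ ^ 2)

/-- The norm of the generalized Sobolev space `H^α(ℝⁿ)` computed on the
Fourier-transform side: `‖w‖_α = (∫ α(⟨ξ⟩)² |ŵ(ξ)|² dξ)^{1/2}`, as an `ℝ≥0∞` value. -/
def HnormE {n : ℕ} (α : ℝ → ℝ) (W : Eucl n → ℂ) : ℝ≥0∞ :=
  (∫⁻ ξ, ENNReal.ofReal ((α (jap ξ)) ^ 2) * (‖W ξ‖₊ : ℝ≥0∞) ^ 2) ^ (1/2 : ℝ)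

open scoped FourierTransform

lemma one_le_jap {n : ℕ} (ξ : Eucl n) : 1 ≤ jap ξ := by
  rw [jap, Real.one_le_sqrt]
  nlinarith [sq_nonneg ‖ξ‖]

lemma norm_le_jap {n : ℕ} (ξ : Eucl n) : ‖ξ‖ ≤ jap ξ :=
  Real.le_sqrt_of_sq_le (by linarith)

lemma continuous_jap {n : ℕ} : Continuous (jap : Eucl n → ℝ) := by
  unfold jap
  fun_prop

lemma RO.roUpperSet_nonempty {α : ℝ → ℝ} (hα : RO α) : (roUpperSet α).Nonempty := by
  obtain ⟨hpos, -, b, hb, c, hc, h⟩ := hα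
  have step : ∀ m : ℕ, ∀ t, 1 ≤ t → ∀ l, 1 ≤ l → l ≤ b ^ m → α (l * t) ≤ c ^ m * α t := by
    intro m
    induction m with
    | zero =>
      intro t ht l hl hl'
      obtain rfl : l = 1 := le_antisymm (by simpa using hl') hl
      simp
    | succ m ih =>
      intro t ht l hl hl'
      have hα := hpos t ht
      rcases le_total l b with hlb | hlb
      · have h1 := (div_le_iff₀ hα).1 (h t ht l hl hlb).2
        refine h1.trans (mul_le_mul_of_nonneg_right ?_ hα.le)
        exact le_self_pow₀ hc (by simp)
      · have hb0 : 0 < b := by linarith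
        have h1 := (div_le_iff₀ hα).1 (h t ht b hb.le le_rfl).2
        have h2 := ih (b * t) (by nlinarith) (l / b) ((one_le_div hb0).2 hlb)
          ((div_le_iff₀ hb0).2 (by rwa [pow_succ] at hl'))
        have e : l / b * (b * t) = l * t := by field_simp
        rw [e] at h2
        calc α (l * t) ≤ c ^ m * α (b * t) := h2
          _ ≤ c ^ m * (c * α t) := by gcongr
          _ = c ^ (m + 1) * α t := by ring
  refine ⟨Real.log c / Real.log b, c, by linarith, fun t ht l hl => ?_⟩
  have hlb : 0 < Real.log b := Real.log_pos hb
  have hl0 : 0 < l := by linarith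
  have hc0 : 0 < c := by linarith
  have hq : 0 ≤ Real.log l / Real.log b := div_nonneg (Real.log_nonneg hl) hlb.le
  set m := ⌈Real.log l / Real.log b⌉₊
  have hm : l ≤ b ^ m := by
    rw [← Real.log_le_log_iff hl0 (by positivity), Real.log_pow, ← div_le_iff₀ hlb]
    exact Nat.le_ceil _
  rw [div_le_iff₀ (hpos t ht)]
  refine (step m t ht l hl hm).trans (mul_le_mul_of_nonneg_right ?_ (hpos t ht).le)
  calc c ^ m = c ^ (m : ℝ) := (Real.rpow_natCast _ _).symm
    _ ≤ c ^ (1 + Real.log l / Real.log b) :=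
      Real.rpow_le_rpow_of_exponent_le hc (by linarith [Nat.ceil_lt_add_one hq])
    _ = c * l ^ (Real.log c / Real.log b) := by
      rw [Real.rpow_add hc0, Real.rpow_one, Real.rpow_def_of_pos hc0, Real.rpow_def_of_pos hl0]
      congr 2
      ring

lemma RO.exists_le_rpow {α : ℝ → ℝ} (hα : RO α) {s : ℝ} (hs : sigma1 α < s) :
    ∃ r < s, ∃ C : ℝ, 0 < C ∧ ∀ t, 1 ≤ t → α t ≤ C * t ^ r := by
  obtain ⟨r, ⟨c, hc, h⟩, hr⟩ := exists_lt_of_csInf_lt hα.roUpperSet_nonempty hs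
  have h1 := hα.1 1 le_rfl
  refine ⟨r, hr, c * α 1, mul_pos hc h1, fun t ht => ?_⟩
  have := (div_le_iff₀ h1).1 (h 1 le_rfl t ht)
  rw [mul_one] at this
  linarith

lemma tendsto_jap_cocompact {n : ℕ} : Tendsto (jap : Eucl n → ℝ) (cocompact (Eucl n)) atTop :=
  tendsto_atTop_mono norm_le_jap tendsto_norm_cocompact_atTop

lemma RO.tendsto_div_rpow {α : ℝ → ℝ} (hα : RO α) {s : ℝ} (hs : sigma1 α < s) (n : ℕ) :
    Tendsto (fun ξ : Eucl n => α (jap ξ) / jap ξ ^ s) (cocompact (Eucl n)) (nhds 0) := by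
  obtain ⟨r, hr, C, hC, h⟩ := hα.exists_le_rpow hs
  have hlim : Tendsto (fun ξ : Eucl n => C * jap ξ ^ (-(s - r))) (cocompact (Eucl n)) (nhds 0) := by
    simpa using ((tendsto_rpow_neg_atTop (sub_pos.2 hr)).comp
      (tendsto_jap_cocompact (n := n))).const_mul C
  refine squeeze_zero (fun ξ => ?_) (fun ξ => ?_) hlim
  · exact div_nonneg (hα.1 _ (one_le_jap ξ)).le
      (Real.rpow_nonneg (zero_le_one.trans (one_le_jap ξ)) _)
  · have hj : 0 < jap ξ := zero_lt_one.trans_le (one_le_jap ξ)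
    rw [div_le_iff₀ (Real.rpow_pos_of_pos hj _), mul_assoc, ← Real.rpow_add hj]
    rw [show -(s - r) + s = r by ring]
    exact h _ (one_le_jap ξ)

lemma continuous_fourier {n : ℕ} {w : Eucl n → ℂ} (hw : Integrable w) : Continuous (𝓕 w) :=
  VectorFourier.fourierIntegral_continuous Real.continuous_fourierChar
    (innerSL ℝ).continuous₂ hw

/-- Reproducing formula: if `𝓕 ψ = 1` on the support of `w`, then `𝓕 w` is the correlation of
itself with `ψ`. -/
lemma fourier_eq_integral_mul {n : ℕ} {w ψ : Eucl n → ℂ} (hw : Integrable w) (hψ : Integrable ψ)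
    (h : ∀ x ∈ Function.support w, 𝓕 ψ x = 1) (ξ : Eucl n) :
    𝓕 w ξ = ∫ η, 𝓕 w η * ψ (η - ξ) := by
  have key : ∀ x, 𝓕 (fun η => ψ (η - ξ)) x = Real.fourierChar (-inner ℝ ξ x) • 𝓕 ψ x := by
    intro x
    have := congrFun (VectorFourier.fourierIntegral_comp_add_right Real.fourierChar
      (volume : Measure (Eucl n)) (innerₗ (Eucl n)) ψ (-ξ)) x
    simpa [sub_eq_add_neg, Circle.smul_def] using! this
  have flip := VectorFourier.integral_fourierIntegral_smul_eq_flip (L := innerₗ (Eucl n))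
    (μ := volume) (ν := volume) Real.continuous_fourierChar continuous_inner hw
    (hψ.comp_sub_right ξ)
  rw [flip_innerₗ] at flip
  refine Eq.trans ?_ flip.symm
  rw [Real.fourier_eq]
  refine integral_congr_ae (.of_forall fun x => ?_)
  by_cases hx : w x = 0
  · simp [hx]
  · have e := key x
    rw [h x hx] at e
    change Real.fourierChar (-inner ℝ x ξ) • w x = w x • 𝓕 (fun η => ψ (η - ξ)) x
    rw [e, real_inner_comm, smul_comm, smul_eq_mul, mul_one]

/-- On a bounded set the translates of a Schwartz function, weighted by `⟨η⟩ ^ r`, are dominated by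
a single square-integrable function. -/
lemma exists_memLp_bound {n : ℕ} (ψ : SchwartzMap (Eucl n) ℂ) (r R : ℝ) :
    ∃ g : Eucl n → ℝ, MemLp g 2 ∧ ∀ ξ ∈ Metric.closedBall (0 : Eucl n) R, ∀ η,
      jap η ^ r * ‖ψ (η - ξ)‖ ≤ g η := by
  set M : ℕ := ⌈|r|⌉₊ + (n + 1)
  obtain ⟨C, hC⟩ : ∃ C : ℝ, ∀ x, (1 + ‖x‖) ^ M * ‖ψ x‖ ≤ C := by
    have := SchwartzMap.one_add_le_sup_seminorm_apply (𝕜 := ℂ) (m := (M, 0)) le_rfl le_rfl ψ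
    simp only [norm_iteratedFDeriv_zero] at this
    exact ⟨_, this⟩
  have hC0 : 0 ≤ C := le_trans (by positivity) (hC 0)
  refine ⟨fun η => C * (1 + |R|) ^ M * (1 + ‖η‖) ^ (-((n : ℝ) + 1)), ?_, fun ξ hξ η => ?_⟩
  · refine MemLp.const_mul ?_ _
    rw [memLp_two_iff_integrable_sq_norm]
    · have := integrable_one_add_norm (E := Eucl n) (μ := volume) (r := 2 * ((n : ℝ) + 1))
        (by simp; linarith)
      refine this.congr (.of_forall fun η => ?_)
      have h0 : 0 < 1 + ‖η‖ := by positivity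
      simp only [Real.norm_eq_abs, sq_abs]
      rw [← Real.rpow_natCast, ← Real.rpow_mul h0.le]
      congr 1
      push_cast
      ring
    · refine Continuous.aestronglyMeasurable ?_
      refine Continuous.rpow_const (by fun_prop) fun η => Or.inl ?_
      positivity
  · have h0 : 0 < 1 + ‖η‖ := by positivity
    have hj : jap η ^ r ≤ (1 + ‖η‖) ^ (⌈|r|⌉₊ : ℝ) :=
      calc jap η ^ r ≤ jap η ^ (⌈|r|⌉₊ : ℝ) :=
            Real.rpow_le_rpow_of_exponent_le (one_le_jap η)
              ((le_abs_self r).trans (Nat.le_ceil _))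
        _ ≤ _ := Real.rpow_le_rpow (zero_le_one.trans (one_le_jap η))
            (sqrt_one_add_norm_sq_le η) (Nat.cast_nonneg _)
    have hξ' : ‖ξ‖ ≤ |R| := (mem_closedBall_zero_iff.1 hξ).trans (le_abs_self R)
    have hP : 1 + ‖η‖ ≤ (1 + |R|) * (1 + ‖η - ξ‖) := by
      have : ‖η‖ ≤ ‖η - ξ‖ + ‖ξ‖ := by simpa using norm_add_le (η - ξ) ξ
      nlinarith [norm_nonneg (η - ξ), abs_nonneg R]
    have hψ : (1 + ‖η‖) ^ M * ‖ψ (η - ξ)‖ ≤ C * (1 + |R|) ^ M :=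
      calc (1 + ‖η‖) ^ M * ‖ψ (η - ξ)‖ ≤ ((1 + |R|) * (1 + ‖η - ξ‖)) ^ M * ‖ψ (η - ξ)‖ := by gcongr
        _ = (1 + |R|) ^ M * ((1 + ‖η - ξ‖) ^ M * ‖ψ (η - ξ)‖) := by rw [mul_pow]; ring
        _ ≤ (1 + |R|) ^ M * C := by gcongr; exact hC _
        _ = _ := mul_comm _ _
    have hM : (1 + ‖η‖) ^ (⌈|r|⌉₊ : ℝ) = (1 + ‖η‖) ^ M * (1 + ‖η‖) ^ (-((n : ℝ) + 1)) := by
      rw [← Real.rpow_natCast (1 + ‖η‖) M, ← Real.rpow_add h0]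
      congr 1
      simp only [M]
      push_cast
      ring
    calc jap η ^ r * ‖ψ (η - ξ)‖
        ≤ (1 + ‖η‖) ^ M * (1 + ‖η‖) ^ (-((n : ℝ) + 1)) * ‖ψ (η - ξ)‖ := by
          rw [← hM]; exact mul_le_mul_of_nonneg_right hj (norm_nonneg _)
      _ = ((1 + ‖η‖) ^ M * ‖ψ (η - ξ)‖) * (1 + ‖η‖) ^ (-((n : ℝ) + 1)) := by ring
      _ ≤ _ := mul_le_mul_of_nonneg_right hψ (Real.rpow_nonneg h0.le _)

/-- A Schwartz function whose Fourier transform equals `1` on a given compact set. -/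
lemma exists_schwartz_fourier_eq_one {n : ℕ} {K : Set (Eucl n)} (hK : IsCompact K) :
    ∃ ψ : SchwartzMap (Eucl n) ℂ, ∀ x ∈ K, 𝓕 (ψ : Eucl n → ℂ) x = 1 := by
  obtain ⟨r, hr, hKr⟩ := hK.isBounded.subset_closedBall_lt 0 0
  let f : ContDiffBump (0 : Eucl n) := ⟨r, r + 1, hr, by linarith⟩
  have hf : HasCompactSupport (Complex.ofRealCLM ∘ f) := f.hasCompactSupport.comp_left rfl
  let χ : SchwartzMap (Eucl n) ℂ :=
    hf.toSchwartzMap (Complex.ofRealCLM.contDiff.comp f.contDiff)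
  refine ⟨𝓕⁻ χ, fun x hx => ?_⟩
  rw [← SchwartzMap.fourier_coe, FourierTransform.fourier_fourierInv_eq]
  change ((f x : ℝ) : ℂ) = 1
  rw [f.one_of_mem_closedBall (hKr hx), Complex.ofReal_one]

/-- Integration against an `L²` function of norm at most `1`, as a functional on `L²`. -/
lemma exists_dual_integral_mul {X : Type*} [MeasurableSpace X] {μ : Measure X} {G : X → ℂ}
    (hG : MemLp G 2 μ) (h1 : eLpNorm G 2 μ ≤ 1) :
    ∃ l : StrongDual ℂ (Lp ℂ 2 μ), ‖l‖ ≤ 1 ∧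
      ∀ (f : X → ℂ) (hf : MemLp f 2 μ), l (hf.toLp f) = ∫ x, G x * f x ∂μ := by
  refine ⟨innerSL ℂ (hG.star.toLp (star G)), ?_, fun f hf => ?_⟩
  · rw [innerSL_apply_norm, Lp.norm_toLp, eLpNorm_star]
    exact ENNReal.toReal_le_of_le_ofReal zero_le_one (by simpa using h1)
  · rw [innerSL_apply_apply, L2.inner_def]
    refine integral_congr_ae ?_
    filter_upwards [hG.star.coeFn_toLp, hf.coeFn_toLp] with x hx hx'
    rw [hx, hx']
    simp [mul_comm]

/-- Weak sequential compactness of the unit ball of `L²`, phrased with integrals. -/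
lemma exists_subseq_tendsto_integral_mul {n : ℕ} {G : ℕ → Eucl n → ℂ} (hG : ∀ k, MemLp (G k) 2)
    (h1 : ∀ k, eLpNorm (G k) 2 volume ≤ 1) :
    ∃ φ : ℕ → ℕ, StrictMono φ ∧ ∀ f : Eucl n → ℂ, MemLp f 2 →
      ∃ L : ℂ, Tendsto (fun k => ∫ x, G (φ k) x * f x) atTop (nhds L) := by
  have : Fact ((2 : ℝ≥0∞) ≠ ∞) := ⟨by simp⟩
  choose l hl hlf using fun k => exists_dual_integral_mul (hG k) (h1 k)
  have hc := WeakDual.isSeqCompact_closedBall ℂ (Lp ℂ 2 (volume : Measure (Eucl n))) 0 1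
  obtain ⟨L, -, φ, hφ, hL⟩ := hc (x := fun k => StrongDual.toWeakDual (l k))
    (fun k => by simpa using! hl k)
  refine ⟨φ, hφ, fun f hf => ⟨L (hf.toLp f), ?_⟩⟩
  have := (WeakDual.eval_continuous (hf.toLp f)).continuousAt.tendsto.comp hL
  refine this.congr fun k => ?_
  exact hlf (φ k) f hf

lemma norm_integral_mul_le_of_eLpNorm_le_one {X : Type*} [MeasurableSpace X] {μ : Measure X}
    {G f : X → ℂ} (hG : MemLp G 2 μ) (h1 : eLpNorm G 2 μ ≤ 1) (hf : MemLp f 2 μ) :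
    ‖∫ x, G x * f x ∂μ‖ ≤ (eLpNorm f 2 μ).toReal := by
  obtain ⟨l, hl, hlf⟩ := exists_dual_integral_mul hG h1
  rw [← hlf f hf, ← Lp.norm_toLp f hf]
  exact (l.le_of_opNorm_le hl _).trans_eq (one_mul _)

lemma eLpNorm_two_jap_mul {n : ℕ} (s : ℝ) (U : Eucl n → ℂ) :
    eLpNorm (fun η => ((jap η ^ s : ℝ) : ℂ) * U η) 2 volume = HnormE (fun t => t ^ s) U := by
  rw [eLpNorm_eq_lintegral_rpow_enorm_toReal two_ne_zero ENNReal.ofNat_ne_top, HnormE]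
  simp only [ENNReal.toReal_ofNat]
  congr 1
  refine lintegral_congr fun η => ?_
  have h0 : 0 ≤ jap η ^ s := Real.rpow_nonneg (zero_le_one.trans (one_le_jap η)) _
  rw [enorm_mul, ← ofReal_norm, Complex.norm_real, Real.norm_of_nonneg h0,
    ENNReal.ofReal_pow h0, ← mul_pow, enorm_eq_nnnorm]
  exact_mod_cast ENNReal.rpow_natCast _ 2

lemma HnormE_le_one_iff {n : ℕ} {α : ℝ → ℝ} {U : Eucl n → ℂ} :
    HnormE α U ≤ 1 ↔
      ∫⁻ ξ, ENNReal.ofReal (α (jap ξ) ^ 2) * (‖U ξ‖₊ : ℝ≥0∞) ^ 2 ≤ 1 := by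
  rw [HnormE]
  constructor
  · intro h
    by_contra! h'
    exact (ENNReal.one_lt_rpow h' (by norm_num)).not_ge h
  · exact fun h => ENNReal.rpow_le_one h (by norm_num)

/-- A sequence of integrable functions supported in a fixed compact set and bounded in `H^{(s)}`
has Fourier transforms that are locally bounded, and a subsequence along which these converge
pointwise. -/
lemma exists_subseq_tendsto_fourier {n : ℕ} {s : ℝ} {K : Set (Eucl n)} (hK : IsCompact K)
    {w : ℕ → Eucl n → ℂ} (hw : ∀ k, Integrable (w k)) (hwK : ∀ k, tsupport (w k) ⊆ K)
    (hb : ∀ k, HnormE (fun t => t ^ s) (𝓕 (w k)) ≤ 1) :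
    (∀ R : ℝ, ∃ A : ℝ, ∀ k, ∀ ξ ∈ Metric.closedBall (0 : Eucl n) R, ‖𝓕 (w k) ξ‖ ≤ A) ∧
    ∃ φ : ℕ → ℕ, StrictMono φ ∧ ∀ ξ, ∃ L : ℂ,
      Tendsto (fun k => 𝓕 (w (φ k)) ξ) atTop (nhds L) := by
  obtain ⟨ψ, hψ⟩ := exists_schwartz_fourier_eq_one hK
  set G : ℕ → Eucl n → ℂ := fun k η => ((jap η ^ s : ℝ) : ℂ) * 𝓕 (w k) η
  set f : Eucl n → Eucl n → ℂ := fun ξ η => ((jap η ^ (-s) : ℝ) : ℂ) * ψ (η - ξ)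
  have hjc : ∀ r : ℝ, Continuous fun η : Eucl n => ((jap η ^ r : ℝ) : ℂ) := fun r =>
    Complex.continuous_ofReal.comp (continuous_jap.rpow_const fun η =>
      Or.inl (zero_lt_one.trans_le (one_le_jap η)).ne')
  have hG1 : ∀ k, eLpNorm (G k) 2 volume ≤ 1 := fun k => (eLpNorm_two_jap_mul s _).trans_le (hb k)
  have hG : ∀ k, MemLp (G k) 2 := fun k =>
    ⟨((hjc s).mul (continuous_fourier (hw k))).aestronglyMeasurable,
      (hG1 k).trans_lt ENNReal.one_lt_top⟩
  have hnorm : ∀ ξ η, ‖f ξ η‖ = jap η ^ (-s) * ‖ψ (η - ξ)‖ := fun ξ η => by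
    rw [norm_mul, Complex.norm_real,
      Real.norm_of_nonneg (Real.rpow_nonneg (zero_le_one.trans (one_le_jap η)) _)]
  have hfc : ∀ ξ, AEStronglyMeasurable (f ξ) volume := fun ξ =>
    ((hjc (-s)).mul (ψ.continuous.comp (continuous_sub_right ξ))).aestronglyMeasurable
  have hf : ∀ ξ, MemLp (f ξ) 2 := fun ξ => by
    obtain ⟨g, hg, hgf⟩ := exists_memLp_bound ψ (-s) ‖ξ‖
    exact hg.mono' (hfc ξ) (.of_forall fun η => (hnorm ξ η).trans_le (hgf ξ (by simp) η))
  have hrep : ∀ k ξ, 𝓕 (w k) ξ = ∫ η, G k η * f ξ η := fun k ξ => by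
    rw [fourier_eq_integral_mul (hw k) ψ.integrable
      (fun x hx => hψ x (hwK k (subset_tsupport _ hx)))]
    refine integral_congr_ae (.of_forall fun η => ?_)
    have hj : ((jap η ^ s : ℝ) : ℂ) * ((jap η ^ (-s) : ℝ) : ℂ) = 1 := by
      rw [← Complex.ofReal_mul, ← Real.rpow_add (zero_lt_one.trans_le (one_le_jap η))]
      simp
    calc 𝓕 (w k) η * ψ (η - ξ)
        = ((jap η ^ s : ℝ) : ℂ) * ((jap η ^ (-s) : ℝ) : ℂ) * (𝓕 (w k) η * ψ (η - ξ)) := by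
          rw [hj, one_mul]
      _ = G k η * f ξ η := by simp only [G, f]; ring
  refine ⟨fun R => ?_, ?_⟩
  · obtain ⟨g, hg, hgf⟩ := exists_memLp_bound ψ (-s) R
    refine ⟨(eLpNorm g 2 volume).toReal, fun k ξ hξ => ?_⟩
    rw [hrep]
    refine (norm_integral_mul_le_of_eLpNorm_le_one (hG k) (hG1 k) (hf ξ)).trans ?_
    exact ENNReal.toReal_mono hg.eLpNorm_ne_top
      (eLpNorm_mono_real fun η => (hnorm ξ η).trans_le (hgf ξ hξ η))
  · obtain ⟨φ, hφ, h⟩ := exists_subseq_tendsto_integral_mul hG hG1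
    refine ⟨φ, hφ, fun ξ => ?_⟩
    simp only [hrep]
    exact h (f ξ) (hf ξ)

lemma nnnorm_sub_sq_le {E : Type*} [SeminormedAddCommGroup E] (a b : E) :
    (‖a - b‖₊ : ℝ≥0∞) ^ 2 ≤ 2 * (‖a‖₊ : ℝ≥0∞) ^ 2 + 2 * (‖b‖₊ : ℝ≥0∞) ^ 2 := by
  have h : ‖a - b‖₊ ^ 2 ≤ 2 * ‖a‖₊ ^ 2 + 2 * ‖b‖₊ ^ 2 := by
    rw [← NNReal.coe_le_coe]
    push_cast
    nlinarith [norm_sub_le a b, norm_nonneg (a - b), sq_nonneg (‖a‖ - ‖b‖)]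
  exact_mod_cast h

/-- A pointwise convergent, uniformly bounded sequence is Cauchy in the mean-square sense on sets
of finite measure. -/
lemma tendsto_setLIntegral_nnnorm_sub_sq {X : Type*} [MeasurableSpace X] {μ : Measure X}
    {B : Set X} (hBm : MeasurableSet B) (hB : μ B ≠ ∞) {U : ℕ → X → ℂ}
    (hU : ∀ k, Measurable (U k)) {A : ℝ≥0} (hA : ∀ k, ∀ x ∈ B, ‖U k x‖₊ ≤ A)
    (hlim : ∀ x, ∃ L : ℂ, Tendsto (fun k => U k x) atTop (nhds L)) :
    Tendsto (fun p : ℕ × ℕ => ∫⁻ x in B, (‖U p.1 x - U p.2 x‖₊ : ℝ≥0∞) ^ 2 ∂μ) atTop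
      (nhds 0) := by
  have h := tendsto_lintegral_filter_of_dominated_convergence (μ := μ.restrict B)
    (l := (atTop : Filter (ℕ × ℕ))) (f := fun _ => 0)
    (F := fun p x => (‖U p.1 x - U p.2 x‖₊ : ℝ≥0∞) ^ 2)
    (fun _ => 2 * (A : ℝ≥0∞) ^ 2 + 2 * (A : ℝ≥0∞) ^ 2) ?_ ?_ ?_ ?_
  · simpa using h
  · exact .of_forall fun p => (((hU p.1).sub (hU p.2)).nnnorm.coe_nnreal_ennreal).pow_const 2
  · refine .of_forall fun p => ?_
    filter_upwards [ae_restrict_mem hBm] with x hx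
    refine (nnnorm_sub_sq_le _ _).trans ?_
    have h1 := hA p.1 x hx
    have h2 := hA p.2 x hx
    gcongr
  · rw [lintegral_const, Measure.restrict_apply_univ]
    finiteness
  · refine .of_forall fun x => ?_
    obtain ⟨L, hL⟩ := hlim x
    have h1 : Tendsto (fun p : ℕ × ℕ => U p.1 x - U p.2 x) atTop (nhds (L - L)) := by
      rw [← prod_atTop_atTop_eq]
      exact (hL.comp tendsto_fst).sub (hL.comp tendsto_snd)
    rw [sub_self] at h1
    have h2 : Tendsto (fun p : ℕ × ℕ => (‖U p.1 x - U p.2 x‖₊ : ℝ≥0∞)) atTop (nhds 0) := by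
      simpa using ENNReal.tendsto_coe.2 h1.nnnorm
    simpa using ENNReal.Tendsto.pow (n := 2) h2

lemma RO.exists_sq_le_of_mem_closedBall {α : ℝ → ℝ} (hα : RO α) (n : ℕ) (R : ℝ) :
    ∃ M : ℝ≥0, ∀ ξ ∈ Metric.closedBall (0 : Eucl n) R,
      ENNReal.ofReal (α (jap ξ) ^ 2) ≤ M := by
  obtain ⟨r, -, C, hC, h⟩ := hα.exists_le_rpow (lt_add_one (sigma1 α))
  have hc : Continuous fun ξ : Eucl n => C * jap ξ ^ r :=
    continuous_const.mul (continuous_jap.rpow_const fun η =>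
      Or.inl (zero_lt_one.trans_le (one_le_jap η)).ne')
  obtain ⟨D, hD⟩ := (isCompact_closedBall (0 : Eucl n) R).exists_bound_of_continuousOn
    hc.continuousOn
  refine ⟨Real.toNNReal (D ^ 2), fun ξ hξ => ENNReal.ofReal_le_ofReal ?_⟩
  have h1 := h _ (one_le_jap ξ)
  have h2 := (le_abs_self _).trans (hD ξ hξ)
  exact pow_le_pow_left₀ (hα.1 _ (one_le_jap ξ)).le (h1.trans h2) 2

/-- Splitting of the `H^α` norm of a difference of two elements of the unit ball of `H^{(s)}` into
low and high frequencies. -/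
lemma lintegral_sub_le_of_weight_le {n : ℕ} {α : ℝ → ℝ} {s δ : ℝ} {M : ℝ≥0}
    (hα : ∀ t, 1 ≤ t → 0 < α t) {B : Set (Eucl n)} (hB : MeasurableSet B)
    (hM : ∀ ξ ∈ B, ENNReal.ofReal (α (jap ξ) ^ 2) ≤ M)
    (hr : ∀ ξ ∉ B, α (jap ξ) ≤ δ * jap ξ ^ s) {U V : Eucl n → ℂ} (hU : Measurable U)
    (hU1 : HnormE (fun t => t ^ s) U ≤ 1)
    (hV1 : HnormE (fun t => t ^ s) V ≤ 1) :
    ∫⁻ ξ, ENNReal.ofReal (α (jap ξ) ^ 2) * (‖U ξ - V ξ‖₊ : ℝ≥0∞) ^ 2 ≤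
      M * (∫⁻ ξ in B, (‖U ξ - V ξ‖₊ : ℝ≥0∞) ^ 2) + ENNReal.ofReal (δ ^ 2) * 4 := by
  rw [HnormE_le_one_iff] at hU1 hV1
  have hw : Measurable fun ξ : Eucl n => ENNReal.ofReal ((jap ξ ^ s) ^ 2) :=
    ((continuous_jap.measurable.pow_const s).pow_const 2).ennreal_ofReal
  have hUm : Measurable fun ξ : Eucl n =>
      2 * (ENNReal.ofReal ((jap ξ ^ s) ^ 2) * (‖U ξ‖₊ : ℝ≥0∞) ^ 2) :=
    (hw.mul (hU.nnnorm.coe_nnreal_ennreal.pow_const 2)).const_mul 2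
  rw [← lintegral_add_compl _ hB]
  refine add_le_add ?_ ?_
  · rw [← lintegral_const_mul' _ _ ENNReal.coe_ne_top]
    exact setLIntegral_mono' hB fun ξ hξ => mul_le_mul_left (hM ξ hξ) _
  · calc ∫⁻ ξ in Bᶜ, ENNReal.ofReal (α (jap ξ) ^ 2) * (‖U ξ - V ξ‖₊ : ℝ≥0∞) ^ 2
        ≤ ∫⁻ ξ in Bᶜ, ENNReal.ofReal (δ ^ 2) *
            (2 * (ENNReal.ofReal ((jap ξ ^ s) ^ 2) * (‖U ξ‖₊ : ℝ≥0∞) ^ 2) +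
              2 * (ENNReal.ofReal ((jap ξ ^ s) ^ 2) * (‖V ξ‖₊ : ℝ≥0∞) ^ 2)) := by
          refine setLIntegral_mono' hB.compl fun ξ hξ => ?_
          have h1 : ENNReal.ofReal (α (jap ξ) ^ 2) ≤
              ENNReal.ofReal (δ ^ 2) * ENNReal.ofReal ((jap ξ ^ s) ^ 2) := by
            rw [← ENNReal.ofReal_mul (sq_nonneg δ), ← mul_pow]
            exact ENNReal.ofReal_le_ofReal
              (pow_le_pow_left₀ (hα _ (one_le_jap ξ)).le (hr ξ hξ) 2)
          refine (mul_le_mul' h1 (nnnorm_sub_sq_le _ _)).trans_eq ?_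
          ring
      _ ≤ ∫⁻ ξ, ENNReal.ofReal (δ ^ 2) *
            (2 * (ENNReal.ofReal ((jap ξ ^ s) ^ 2) * (‖U ξ‖₊ : ℝ≥0∞) ^ 2) +
              2 * (ENNReal.ofReal ((jap ξ ^ s) ^ 2) * (‖V ξ‖₊ : ℝ≥0∞) ^ 2)) :=
          setLIntegral_le_lintegral _ _
      _ = ENNReal.ofReal (δ ^ 2) *
            (2 * (∫⁻ ξ, ENNReal.ofReal ((jap ξ ^ s) ^ 2) * (‖U ξ‖₊ : ℝ≥0∞) ^ 2) +
              2 * (∫⁻ ξ, ENNReal.ofReal ((jap ξ ^ s) ^ 2) * (‖V ξ‖₊ : ℝ≥0∞) ^ 2)) := by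
          rw [lintegral_const_mul' _ _ ENNReal.ofReal_ne_top, lintegral_add_left hUm,
            lintegral_const_mul' _ _ ENNReal.ofNat_ne_top,
            lintegral_const_mul' _ _ ENNReal.ofNat_ne_top]
      _ ≤ ENNReal.ofReal (δ ^ 2) * (2 * 1 + 2 * 1) := by gcongr
      _ = ENNReal.ofReal (δ ^ 2) * 4 := by norm_num

/-- For `s > σ₁(α)` the weight ratio `α(⟨ξ⟩)/⟨ξ⟩^s` tends to `0` as `|ξ| → ∞`;
consequently the embedding `H^{(s)}(ℝⁿ) ⊂ H^α(ℝⁿ)`, restricted to distributions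
supported in a fixed compact set, is compact: every sequence bounded in `H^{(s)}`
and supported in a fixed compact set has a subsequence which is Cauchy in `H^α`. -/
theorem halpha_compact_embedding (n : ℕ) (α : ℝ → ℝ) (hα : RO α) (s : ℝ)
    (hs : sigma1 α < s) :
    Tendsto (fun ξ : Eucl n => α (jap ξ) / (jap ξ) ^ s)
      (Filter.cocompact (Eucl n)) (nhds 0) ∧
    ∀ K : Set (Eucl n), IsCompact K →
      ∀ w : ℕ → Eucl n → ℂ, (∀ k, Integrable (w k)) →
        (∀ k, tsupport (w k) ⊆ K) →
        (∀ k, HnormE (fun t => t ^ s) (𝓕 (w k)) ≤ 1) →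
        ∃ φ : ℕ → ℕ, StrictMono φ ∧ ∀ ε : ℝ, 0 < ε → ∃ N : ℕ, ∀ j ≥ N, ∀ k ≥ N,
          HnormE α (fun ξ => 𝓕 (w (φ j)) ξ - 𝓕 (w (φ k)) ξ) < ENNReal.ofReal ε := by
  refine ⟨hα.tendsto_div_rpow hs n, fun K hK w hw hwK hb => ?_⟩
  obtain ⟨hbd, φ, hφ, hlim⟩ := exists_subseq_tendsto_fourier hK hw hwK hb
  refine ⟨φ, hφ, fun ε hε => ?_⟩
  have hm : ∀ k, Measurable (𝓕 (w k)) := fun k => (continuous_fourier (hw k)).measurable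
  have hδ : 0 < ε / 4 := by positivity
  obtain ⟨T, hT, hTr⟩ := mem_cocompact.1
    ((hα.tendsto_div_rpow hs n).eventually (gt_mem_nhds hδ))
  obtain ⟨R, hR⟩ := hT.isBounded.subset_closedBall 0
  obtain ⟨A, hA⟩ := hbd R
  obtain ⟨M, hM⟩ := hα.exists_sq_le_of_mem_closedBall n R
  have hlow := tendsto_setLIntegral_nnnorm_sub_sq (μ := volume)
    (Metric.isClosed_closedBall (x := (0 : Eucl n)) (ε := R)).measurableSet
    measure_closedBall_lt_top.ne (fun k => hm (φ k)) (A := A.toNNReal)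
    (fun k ξ hξ => NNReal.le_toNNReal_of_coe_le (hA (φ k) ξ hξ)) hlim
  have hlow' := ENNReal.Tendsto.const_mul hlow (Or.inr (ENNReal.coe_ne_top (r := M)))
  rw [mul_zero] at hlow'
  have hev := hlow'.eventually (gt_mem_nhds (ENNReal.ofReal_pos.2
    (show 0 < ε ^ 2 / 2 by positivity)))
  rw [eventually_atTop] at hev
  obtain ⟨⟨N₁, N₂⟩, hN⟩ := hev
  refine ⟨max N₁ N₂, fun j hj k hk => ?_⟩
  have hjk := hN (j, k) ⟨(le_max_left _ _).trans hj, (le_max_right _ _).trans hk⟩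
  have hle := lintegral_sub_le_of_weight_le (s := s) hα.1
    (Metric.isClosed_closedBall (x := (0 : Eucl n)) (ε := R)).measurableSet hM
    (fun ξ hξ => by
      have := hTr (show ξ ∈ Tᶜ from fun h => hξ (hR h))
      exact ((div_lt_iff₀ (Real.rpow_pos_of_pos
        (zero_lt_one.trans_le (one_le_jap ξ)) s)).1 this).le)
    (hm (φ j)) (hb (φ j)) (hb (φ k))
  have hlt : ∫⁻ ξ, ENNReal.ofReal (α (jap ξ) ^ 2) *
      (‖𝓕 (w (φ j)) ξ - 𝓕 (w (φ k)) ξ‖₊ : ℝ≥0∞) ^ 2 < ENNReal.ofReal ε ^ (2 : ℝ) := by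
    have h4 : ENNReal.ofReal ((ε / 4) ^ 2) * 4 = ENNReal.ofReal (ε ^ 2 / 4) := by
      rw [show (4 : ℝ≥0∞) = ENNReal.ofReal 4 by simp, ← ENNReal.ofReal_mul (by positivity)]
      congr 1
      ring
    have hfin : ENNReal.ofReal (ε ^ 2 / 4) ≠ ∞ := ENNReal.ofReal_ne_top
    rw [h4] at hle
    refine hle.trans_lt ((ENNReal.add_lt_add_right hfin hjk).trans_le ?_)
    rw [← ENNReal.ofReal_add (by positivity) (by positivity),
      ENNReal.ofReal_rpow_of_pos hε]
    refine ENNReal.ofReal_le_ofReal ?_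
    rw [Real.rpow_two]
    nlinarith [sq_nonneg ε]
  have := ENNReal.rpow_lt_rpow hlt (show (0 : ℝ) < 1 / 2 by norm_num)
  rwa [← ENNReal.rpow_mul, show (2 : ℝ) * (1 / 2) = 1 by norm_num, ENNReal.rpow_one] at this
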